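/- arXiv:2104.01269 — 2 statements merged into one kernel-verified Lean document; each statement's English description precedes it below -/
import Mathlib

section
/- Let X be a δ-hyperbolic geodesic metric space and l > 0. Suppose c is a piecewise geodesic path in X consisting of geodesic segments each of length greater than 2l + 8δ, such that at each interior breakpoint p_i the Gromov product (p_{i−1}|p_{i+1})_{p_i} is at most l. Let γ be a geodesic with the same endpoints as c. Then the Hausdorff distance between γ and c is at most l + 4δ. -/
open Metric Set Filter

/-- Gromov product of `x` and `y` at `p`. -/
noncomputable def gp {X : Type*} [MetricSpace X] (p x y : X) : ℝ :=
  (dist x p + dist y p - dist x y) / 2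

/-- `f` parametrizes a geodesic segment from `x` to `y` (unit speed on `[0, dist x y]`). -/
def IsGeodSeg {X : Type*} [MetricSpace X] (f : ℝ → X) (x y : X) : Prop :=
  f 0 = x ∧ f (dist x y) = y ∧
    ∀ s ∈ Set.Icc (0:ℝ) (dist x y), ∀ t ∈ Set.Icc (0:ℝ) (dist x y),
      dist (f s) (f t) = |s - t|

/-- The image of the geodesic segment parametrized by `f` from `x` to `y`. -/
def segImg {X : Type*} [MetricSpace X] (f : ℝ → X) (x y : X) : Set X :=
  f '' Set.Icc 0 (dist x y)

/-- A geodesic metric space: any two points are joined by a geodesic segment. -/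
def GeodesicSpace (X : Type*) [MetricSpace X] : Prop :=
  ∀ x y : X, ∃ f, IsGeodSeg f x y

/-- All geodesic triangles are `δ`-slim. -/
def SlimTriangles (X : Type*) [MetricSpace X] (δ : ℝ) : Prop :=
  ∀ (x y z : X) (fxy fyz fxz : ℝ → X),
    IsGeodSeg fxy x y → IsGeodSeg fyz y z → IsGeodSeg fxz x z →
    ∀ p ∈ segImg fxy x y, ∃ q ∈ segImg fyz y z ∪ segImg fxz x z, dist p q ≤ δ

/-- `ν`-hyperbolicity expressed through the Gromov-product (four point) inequality. -/
def GromovHyp (X : Type*) [MetricSpace X] (ν : ℝ) : Prop :=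
  ∀ p x y z : X, min (gp p x z) (gp p y z) - ν ≤ gp p x y

/-- `f` is a unit-speed geodesic ray starting at `p`. -/
def IsGeodRay {X : Type*} [MetricSpace X] (f : ℝ → X) (p : X) : Prop :=
  f 0 = p ∧ ∀ s ∈ Set.Ici (0:ℝ), ∀ t ∈ Set.Ici (0:ℝ), dist (f s) (f t) = |s - t|

/-- Two rays are asymptotic (converge to the same boundary point). -/
def AsympRays {X : Type*} [MetricSpace X] (r r' : ℝ → X) : Prop :=
  ∃ C : ℝ, ∀ t : ℝ, 0 ≤ t → ∃ s : ℝ, 0 ≤ s ∧ dist (r t) (r' s) ≤ C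

/-- `q` lies between `a` and `b`. -/
def Btw3 {X : Type*} [MetricSpace X] (a q b : X) : Prop := dist a q + dist q b = dist a b

/-- `x` is `r`-close to some geodesic from `a` to `b`. -/
def Nr {X : Type*} [MetricSpace X] (r : ℝ) (x a b : X) : Prop :=
  ∃ q, Btw3 a q b ∧ dist x q ≤ r

section helpers
variable {X : Type*} [MetricSpace X]

lemma Btw3.symm {a q b : X} (h : Btw3 a q b) : Btw3 b q a := by
  unfold Btw3 at *
  rw [dist_comm b q, dist_comm q a, dist_comm b a]; linarith

lemma Nr.symm {r : ℝ} {x a b : X} (h : Nr r x a b) : Nr r x b a := by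
  obtain ⟨q, h1, h2⟩ := h
  exact ⟨q, h1.symm, h2⟩

lemma Nr.mono {r s : ℝ} {x a b : X} (h : Nr r x a b) (hs : r ≤ s) : Nr s x a b := by
  obtain ⟨q, h1, h2⟩ := h
  exact ⟨q, h1, h2.trans hs⟩

lemma Nr.gp {r : ℝ} {x a b : X} (h : Nr r x a b) : dist x a + dist x b - dist a b ≤ 2 * r := by
  obtain ⟨q, h1, h2⟩ := h
  unfold Btw3 at h1
  have := dist_triangle x q a
  have := dist_triangle x q b
  have := dist_comm a q
  linarith

lemma Nr.start {r : ℝ} (hr : 0 ≤ r) (a b : X) : Nr r a a b :=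
  ⟨a, by simp [Btw3], by simpa using hr⟩

lemma IsGeodSeg.rev {f : ℝ → X} {x y : X} (h : IsGeodSeg f x y) :
    IsGeodSeg (fun t => f (dist x y - t)) y x ∧
      segImg (fun t => f (dist x y - t)) y x = segImg f x y := by
  obtain ⟨h0, h1, h2⟩ := h
  refine ⟨⟨by simpa using h1, by simpa [dist_comm y x] using h0, ?_⟩, ?_⟩
  · intro s hs t ht
    rw [dist_comm y x] at hs ht
    have := h2 (dist x y - s) ⟨by linarith [hs.2], by linarith [hs.1]⟩
      (dist x y - t) ⟨by linarith [ht.2], by linarith [ht.1]⟩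
    simp only [this]
    rw [abs_sub_comm]; congr 1; ring
  · unfold segImg
    rw [dist_comm y x]
    ext z
    constructor
    · rintro ⟨t, ht, rfl⟩
      exact ⟨dist x y - t, ⟨by linarith [ht.2], by linarith [ht.1]⟩, rfl⟩
    · rintro ⟨t, ht, rfl⟩
      exact ⟨dist x y - t, ⟨by linarith [ht.2], by linarith [ht.1]⟩, by simp⟩

lemma btw_of_seg {f : ℝ → X} {x y z : X} (h : IsGeodSeg f x y) (hz : z ∈ segImg f x y) :
    Btw3 x z y := by
  obtain ⟨h0, h1, h2⟩ := h
  obtain ⟨t, ht, rfl⟩ := hz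
  have a := h2 0 ⟨le_rfl, dist_nonneg⟩ t ht
  have b := h2 t ht (dist x y) ⟨dist_nonneg, le_rfl⟩
  rw [h0] at a
  rw [h1] at b
  unfold Btw3
  rw [a, b, abs_of_nonpos (by linarith [ht.1]), abs_of_nonpos (by linarith [ht.2])]
  ring

lemma start_mem {f : ℝ → X} {x y : X} (h : IsGeodSeg f x y) : x ∈ segImg f x y :=
  ⟨0, ⟨le_rfl, dist_nonneg⟩, h.1⟩

lemma end_mem {f : ℝ → X} {x y : X} (h : IsGeodSeg f x y) : y ∈ segImg f x y :=
  ⟨dist x y, ⟨dist_nonneg, le_rfl⟩, h.2.1⟩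

lemma seg_through (hgeo : GeodesicSpace X) {a q b : X} (h : Btw3 a q b) :
    ∃ f, IsGeodSeg f a b ∧ q ∈ segImg f a b := by
  obtain ⟨f, f0, f1, f2⟩ := hgeo a q
  obtain ⟨g, g0, g1, g2⟩ := hgeo q b
  unfold Btw3 at h
  have n1 : 0 ≤ dist a q := dist_nonneg
  have n2 : 0 ≤ dist q b := dist_nonneg
  set F : ℝ → X := fun t => if t ≤ dist a q then f t else g (t - dist a q) with hF
  have F0 : F 0 = a := by simp [hF, f0]
  have F1 : F (dist a b) = b := by
    by_cases hc : dist a b ≤ dist a q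
    · have e : dist q b = 0 := by linarith
      have e1 : dist a b = dist a q := by linarith
      simp only [hF]
      rw [if_pos hc, e1, f1]
      exact dist_eq_zero.1 e
    · simp only [hF]
      rw [if_neg hc, show dist a b - dist a q = dist q b by linarith, g1]
  have key : ∀ s ∈ Set.Icc (0:ℝ) (dist a b), ∀ t ∈ Set.Icc (0:ℝ) (dist a b), s ≤ t →
      dist (F s) (F t) = |s - t| := by
    intro s hs t ht hst
    by_cases c1 : t ≤ dist a q
    · have c2 : s ≤ dist a q := hst.trans c1
      simp only [hF, if_pos c1, if_pos c2]
      exact f2 s ⟨hs.1, c2⟩ t ⟨ht.1, c1⟩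
    · push Not at c1
      by_cases c2 : s ≤ dist a q
      · simp only [hF, if_neg (not_le.2 c1), if_pos c2]
        have e1 := f2 0 ⟨le_rfl, n1⟩ s ⟨hs.1, c2⟩
        have e2 := f2 s ⟨hs.1, c2⟩ (dist a q) ⟨n1, le_rfl⟩
        have hm : t - dist a q ∈ Set.Icc 0 (dist q b) := ⟨by linarith, by linarith [ht.2]⟩
        have e3 := g2 0 ⟨le_rfl, n2⟩ (t - dist a q) hm
        have e4 := g2 (t - dist a q) hm (dist q b) ⟨n2, le_rfl⟩
        rw [f0, abs_of_nonpos (by linarith [hs.1])] at e1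
        rw [f1, abs_of_nonpos (by linarith)] at e2
        rw [g0, abs_of_nonpos (by linarith)] at e3
        rw [g1, abs_of_nonpos (by linarith [ht.2])] at e4
        rw [abs_of_nonpos (by linarith)]
        have t1 := dist_triangle (f s) q (g (t - dist a q))
        have t2 := dist_triangle a (f s) b
        have t3 := dist_triangle (f s) (g (t - dist a q)) b
        linarith
      · push Not at c2
        simp only [hF, if_neg (not_le.2 c1), if_neg (not_le.2 c2)]
        rw [g2 (s - dist a q) ⟨by linarith, by linarith [hs.2]⟩ (t - dist a q)
          ⟨by linarith, by linarith [ht.2]⟩]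
        congr 1; ring
  refine ⟨F, ⟨F0, F1, ?_⟩, ⟨dist a q, ⟨n1, by linarith⟩, by simp [hF, f1]⟩⟩
  intro s hs t ht
  rcases le_total s t with hst | hst
  · exact key s hs t ht hst
  · rw [dist_comm, abs_sub_comm]
    exact key t ht s hs hst

variable {δ l : ℝ}

lemma slim_spec (hgeo : GeodesicSpace X) (hslim : SlimTriangles X δ) {a q b c : X}
    (h : Btw3 a q b) {f g : ℝ → X} (hf : IsGeodSeg f a c) (hg : IsGeodSeg g b c) :
    ∃ z, (z ∈ segImg f a c ∨ z ∈ segImg g b c) ∧ dist q z ≤ δ := by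
  obtain ⟨F, h1, h2⟩ := seg_through hgeo h
  obtain ⟨z, hz, hd⟩ := hslim a b c F g f h1 hg hf q h2
  exact ⟨z, hz.symm, hd⟩

lemma Nr.step (hgeo : GeodesicSpace X) (hslim : SlimTriangles X δ) {r : ℝ} {x a b : X}
    (h : Nr r x a b) (c : X) : Nr (r + δ) x a c ∨ Nr (r + δ) x c b := by
  obtain ⟨q, h1, h2⟩ := h
  obtain ⟨f, hf⟩ := hgeo a c
  obtain ⟨g, hg⟩ := hgeo b c
  obtain ⟨z, hz, hd⟩ := slim_spec hgeo hslim h1 hf hg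
  have := dist_triangle x q z
  rcases hz with hz | hz
  · exact Or.inl ⟨z, btw_of_seg hf hz, by linarith⟩
  · exact Or.inr ⟨z, (btw_of_seg hg hz).symm, by linarith⟩

lemma near_gp (hgeo : GeodesicSpace X) (hslim : SlimTriangles X δ) (p x y : X) :
    Nr ((dist p x + dist p y - dist x y) / 2 + 2 * δ) p x y := by
  obtain ⟨f, hf⟩ := hgeo x y
  obtain ⟨f0, f1, f2⟩ := hf
  have hcont : ContinuousOn f (Set.Icc 0 (dist x y)) := by
    refine LipschitzOnWith.continuousOn (K := 1) ?_
    refine LipschitzOnWith.of_dist_le_mul ?_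
    intro s hs t ht
    rw [f2 s hs t ht, Real.dist_eq]; simp
  have hψ : ContinuousOn (fun t => (dist (f t) x - dist p x) - (dist (f t) y - dist p y))
      (Set.Icc 0 (dist x y)) := by fun_prop
  have ivt := intermediate_value_Icc (dist_nonneg : 0 ≤ dist x y) hψ
  have h0 : (0:ℝ) ∈ Set.Icc ((dist (f 0) x - dist p x) - (dist (f 0) y - dist p y))
      ((dist (f (dist x y)) x - dist p x) - (dist (f (dist x y)) y - dist p y)) := by
    rw [f0, f1]
    have := dist_triangle p x y
    have := dist_triangle p y x
    have := dist_comm x y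
    simp only [dist_self]
    constructor <;> linarith
  obtain ⟨t, ht, hte⟩ := ivt h0
  have hb : Btw3 x (f t) y := btw_of_seg ⟨f0, f1, f2⟩ ⟨t, ht, rfl⟩
  have hN : Nr 0 (f t) x y := ⟨f t, hb, by simp⟩
  refine ⟨f t, hb, ?_⟩
  unfold Btw3 at hb
  have c1 := dist_comm x (f t)
  have c2 := dist_comm x p
  have c3 := dist_comm (f t) p
  simp only at hte
  rcases hN.step hgeo hslim p with h | h
  · have := h.gp
    linarith
  · have := h.gp
    linarith

lemma chain_fwd (hδ : 0 ≤ δ) (hl : 0 < l) (hgeo : GeodesicSpace X) (hslim : SlimTriangles X δ)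
    (k : ℕ) (p : ℕ → X)
    (hlen : ∀ i < k, 2 * l + 8 * δ < dist (p i) (p (i + 1)))
    (hc : ∀ i, i + 1 < k →
      dist (p (i+1)) (p i) + dist (p (i+1)) (p (i+2)) - dist (p i) (p (i+2)) ≤ 2 * l) :
    ∀ i < k, Nr (l + 3 * δ) (p i) (p 0) (p (i + 1)) := by
  intro i
  induction i with
  | zero => intro _; exact Nr.start (by linarith) _ _
  | succ i ih =>
    intro hi
    have h1 := (ih (by omega)).gp
    have h2 := hlen i (by omega)
    have h3 := hc i hi
    have h4 : Nr (l + 2 * δ) (p (i+1)) (p i) (p (i+2)) :=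
      (near_gp hgeo hslim _ _ _).mono (by linarith)
    rcases h4.step hgeo hslim (p 0) with h | h
    · have h5 := h.gp
      have := dist_comm (p i) (p (i+1))
      have := dist_comm (p 0) (p (i+1))
      linarith
    · exact h.mono (by linarith)

lemma chain_bwd (hδ : 0 ≤ δ) (hl : 0 < l) (hgeo : GeodesicSpace X) (hslim : SlimTriangles X δ)
    (k : ℕ) (p : ℕ → X)
    (hlen : ∀ i < k, 2 * l + 8 * δ < dist (p i) (p (i + 1)))
    (hc : ∀ i, i + 1 < k →
      dist (p (i+1)) (p i) + dist (p (i+1)) (p (i+2)) - dist (p i) (p (i+2)) ≤ 2 * l) :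
    ∀ i < k, Nr (l + 3 * δ) (p (i + 1)) (p i) (p k) := by
  intro i hi
  have := chain_fwd hδ hl hgeo hslim k (fun j => p (k - j)) ?_ ?_ (k - (i + 1)) (by omega)
  · skip
    rw [show k - (k - (i+1)) = i + 1 by omega, show k - (k - (i+1) + 1) = i by omega,
      show k - 0 = k by omega] at this
    exact this.symm
  · intro j hj
    have := hlen (k - (j + 1)) (by omega)
    rw [show k - (j+1) + 1 = k - j by omega, dist_comm] at this
    exact this
  · intro j hj
    have := hc (k - (j + 2)) (by omega)
    rw [show k - (j+2) + 1 = k - (j + 1) by omega, show k - (j+2) + 2 = k - j by omega] at this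
    rw [dist_comm (p (k - j)) (p (k - (j + 2)))]
    linarith

lemma tail_near (hδ : 0 ≤ δ) (hgeo : GeodesicSpace X) (hslim : SlimTriangles X δ) {S E R x : X} {γ : ℝ → X}
    (hγ : IsGeodSeg γ S E) {r : ℝ} (h : Nr r x S R)
    (hR : R = E ∨ 2 * (r + δ) < dist x R + dist x E - dist R E) :
    ∃ z ∈ segImg γ S E, dist x z ≤ r + δ := by
  obtain ⟨q, h1, h2⟩ := h
  obtain ⟨g, hg⟩ := hgeo R E
  obtain ⟨z, hz, hd⟩ := slim_spec hgeo hslim h1 hγ hg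
  have t := dist_triangle x q z
  rcases hz with hz | hz
  · exact ⟨z, hz, by linarith⟩
  · have hb := btw_of_seg hg hz
    rcases hR with rfl | hR
    · have : z = R := by
        unfold Btw3 at hb
        rw [dist_self] at hb
        have n1 : 0 ≤ dist R z := dist_nonneg
        have n2 : 0 ≤ dist z R := dist_nonneg
        exact dist_eq_zero.1 (by linarith)
      subst this
      exact ⟨z, end_mem hγ, by linarith⟩
    · have : Nr (r + δ) x R E := ⟨z, hb, by linarith⟩
      linarith [this.gp]

lemma corner_core (hδ : 0 ≤ δ) (hl : 0 < l) (hgeo : GeodesicSpace X) (hslim : SlimTriangles X δ)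
    {S P Q R E x : X} {γ : ℝ → X} (hγ : IsGeodSeg γ S E) (hx : Btw3 P x Q)
    (hP : dist P S + dist P Q - dist S Q ≤ 2 * l + 6 * δ)
    (hR : R = E ∨ (2 * l + 8 * δ < dist Q R ∧ dist R Q + dist R E - dist Q E ≤ 2 * l + 6 * δ))
    {M : ℝ} (hM : Nr M x P R) (h1 : M < dist P x - l - 4 * δ)
    (h2 : M ≤ l + 3 * δ - (dist x Q + dist Q R - dist x R) / 2) (h3 : M ≤ l + 2 * δ) :
    ∃ z ∈ segImg γ S E, dist x z ≤ l + 4 * δ := by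
  unfold Btw3 at hx
  rcases hM.step hgeo hslim S with h | h
  · exfalso
    have a := h.gp
    have := dist_triangle S x Q
    have := dist_comm S x
    have := dist_comm P x
    linarith
  · obtain ⟨z, hz, hd⟩ := tail_near hδ hgeo hslim hγ h (by
      rcases hR with h | ⟨h4, h5⟩
      · exact Or.inl h
      · right
        have := dist_triangle Q x E
        have := dist_comm Q x
        have := dist_comm Q R
        linarith)
    exact ⟨z, hz, by linarith⟩

lemma corner (hδ : 0 ≤ δ) (hl : 0 < l) (hgeo : GeodesicSpace X) (hslim : SlimTriangles X δ)
    {S P Q R E x : X} {γ : ℝ → X} (hγ : IsGeodSeg γ S E) (hx : Btw3 P x Q)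
    (hL : 2 * l + 8 * δ < dist P Q)
    (hP : dist P S + dist P Q - dist S Q ≤ 2 * l + 6 * δ)
    (hQ : dist Q P + dist Q R - dist P R ≤ 2 * l)
    (hR : R = E ∨ (2 * l + 8 * δ < dist Q R ∧ dist R Q + dist R E - dist Q E ≤ 2 * l + 6 * δ))
    (hb : dist x Q ≤ l + 3 * δ) :
    ∃ z ∈ segImg γ S E, dist x z ≤ l + 4 * δ := by
  have hx' := hx
  unfold Btw3 at hx'
  have c1 := dist_comm P x
  have c2 := dist_comm P Q
  have c3 := dist_comm x Q
  have t1 := dist_triangle P x R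
  have t2 := dist_triangle x Q R
  by_cases hc : dist x Q ≤ 2 * δ + (dist x Q + dist Q R - dist x R) / 2
  · refine corner_core hδ hl hgeo hslim hγ hx hP hR
      (M := l + 2 * δ - (dist x Q + dist Q R - dist x R) / 2)
      ((near_gp hgeo hslim x P R).mono ?_) ?_ ?_ ?_ <;> linarith
  · push Not at hc
    obtain ⟨Q', hQ', hd⟩ := near_gp hgeo hslim Q P R
    have hx0 : Nr 0 x P Q := ⟨x, hx, by simp⟩
    rcases hx0.step hgeo hslim Q' with h | h
    · have : Nr δ x P R := by
        obtain ⟨z, hz, hzd⟩ := h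
        refine ⟨z, ?_, by linarith⟩
        unfold Btw3 at *
        have := dist_triangle P z R
        have := dist_triangle z Q' R
        linarith
      exact corner_core hδ hl hgeo hslim hγ hx hP hR this (by linarith) (by linarith) (by linarith)
    · have : Nr (l + 4 * δ - dist x Q) x P R := by
        obtain ⟨z, hz, hzd⟩ := h
        refine ⟨Q', hQ', ?_⟩
        unfold Btw3 at hz
        have := dist_triangle x z Q'
        have := dist_triangle x z Q
        have := dist_comm z Q'
        have := dist_comm Q Q'
        linarith
      exact corner_core hδ hl hgeo hslim hγ hx hP hR this (by linarith) (by linarith) (by linarith)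

lemma middle (hδ : 0 ≤ δ) (hl : 0 < l) (hgeo : GeodesicSpace X) (hslim : SlimTriangles X δ)
    {S O P Q R E x : X} {γ : ℝ → X} (hγ : IsGeodSeg γ S E) (hx : Btw3 P x Q)
    (hP : dist P Q + dist P O - dist Q O ≤ 2 * l)
    (hQ : dist Q P + dist Q R - dist P R ≤ 2 * l)
    (hR : R = E ∨ (2 * l + 8 * δ < dist Q R ∧ dist R Q + dist R E - dist Q E ≤ 2 * l + 6 * δ))
    (hO : O = S ∨ (2 * l + 8 * δ < dist P O ∧ dist O P + dist O S - dist P S ≤ 2 * l + 6 * δ))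
    (ha : l + 3 * δ < dist P x)
    (hb : l + 3 * δ < dist x Q) :
    ∃ z ∈ segImg γ S E, dist x z ≤ l + 4 * δ := by
  have hx' := hx
  unfold Btw3 at hx'
  have c1 := dist_comm P x
  have c2 := dist_comm P Q
  have c3 := dist_comm x Q
  have c4 := dist_comm R Q
  have c5 := dist_comm O P
  have t1 := dist_triangle P x R
  have t2 := dist_triangle x Q R
  have t3 := dist_triangle Q x O
  have hx0 : Nr 0 x P Q := ⟨x, hx, by simp⟩
  rcases hx0.step hgeo hslim R with h | h
  swap
  · have := h.gp
    linarith
  rcases h.step hgeo hslim O with h | h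
  · have := h.gp
    linarith
  have hS : Nr (3 * δ) x S R := by
    rcases hO with rfl | ⟨h4, h5⟩
    · exact h.mono (by linarith)
    · rcases h.step hgeo hslim S with h | h
      · have := h.gp
        have := dist_triangle P x S
        linarith
      · exact h.mono (by linarith)
  obtain ⟨z, hz, hd⟩ := tail_near hδ hgeo hslim hγ hS (by
      rcases hR with h | ⟨h4, h5⟩
      · exact Or.inl h
      · right
        have := dist_triangle Q x E
        linarith)
  exact ⟨z, hz, by linarith⟩

lemma seg_near (hδ : 0 ≤ δ) (hl : 0 < l) (hgeo : GeodesicSpace X) (hslim : SlimTriangles X δ)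
    {S O P Q R E x : X} {γ : ℝ → X} (hγ : IsGeodSeg γ S E) (hx : Btw3 P x Q)
    (hL : 2 * l + 8 * δ < dist P Q)
    (hP' : dist P S + dist P Q - dist S Q ≤ 2 * l + 6 * δ)
    (hQ' : dist Q E + dist Q P - dist E P ≤ 2 * l + 6 * δ)
    (hP : dist P Q + dist P O - dist Q O ≤ 2 * l)
    (hQ : dist Q P + dist Q R - dist P R ≤ 2 * l)
    (hR : R = E ∨ (2 * l + 8 * δ < dist Q R ∧ dist R Q + dist R E - dist Q E ≤ 2 * l + 6 * δ))
    (hO : O = S ∨ (2 * l + 8 * δ < dist P O ∧ dist O P + dist O S - dist P S ≤ 2 * l + 6 * δ)) :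
    ∃ z ∈ segImg γ S E, dist x z ≤ l + 4 * δ := by
  by_cases hb : dist x Q ≤ l + 3 * δ
  · exact corner hδ hl hgeo hslim hγ hx hL hP' hQ hR hb
  by_cases ha : dist P x ≤ l + 3 * δ
  · obtain ⟨h1, h2⟩ := hγ.rev
    rw [← h2]
    exact corner hδ hl hgeo hslim h1 hx.symm (by rwa [dist_comm Q P]) hQ' hP hO
      (by rwa [dist_comm x P])
  push Not at ha hb
  exact middle hδ hl hgeo hslim hγ hx hP hQ hR hO ha hb

end helpers

/-- broken geodesic lemma. If `c = c₁⋯c_k` is a piecewise geodesic in a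
δ-hyperbolic (δ-slim) geodesic space whose segments have length `> 2l + 8δ` and whose
Gromov products at the corners are `≤ l`, and `γ` is a geodesic with the same endpoints,
then the Hausdorff distance between `γ` and `c` is at most `l + 4δ`. -/
theorem stmt2 {X : Type*} [MetricSpace X] (δ l : ℝ) (hδ : 0 ≤ δ) (hl : 0 < l)
    (hgeo : GeodesicSpace X) (hslim : SlimTriangles X δ)
    (k : ℕ) (hk : 1 ≤ k) (p : ℕ → X) (f : ℕ → ℝ → X)
    (hf : ∀ i < k, IsGeodSeg (f i) (p i) (p (i + 1)))
    (hlen : ∀ i < k, 2 * l + 8 * δ < dist (p i) (p (i + 1)))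
    (hcorner : ∀ i, 1 ≤ i → i < k → gp (p i) (p (i - 1)) (p (i + 1)) ≤ l)
    (γ : ℝ → X) (hγ : IsGeodSeg γ (p 0) (p k)) :
    Metric.hausdorffDist (segImg γ (p 0) (p k))
      (⋃ i ∈ Finset.range k, segImg (f i) (p i) (p (i + 1))) ≤ l + 4 * δ := by
  have hc : ∀ i, i + 1 < k →
      dist (p (i+1)) (p i) + dist (p (i+1)) (p (i+2)) - dist (p i) (p (i+2)) ≤ 2 * l := by
    intro i hi
    have := hcorner (i + 1) (by omega) hi
    unfold gp at this
    simp only [Nat.add_sub_cancel, show i + 1 + 1 = i + 2 from rfl] at this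
    rw [dist_comm (p (i+1)) (p i), dist_comm (p (i+1)) (p (i+2))]
    linarith
  have hA := chain_fwd hδ hl hgeo hslim k p hlen hc
  have hB := chain_bwd hδ hl hgeo hslim k p hlen hc
  refine Metric.hausdorffDist_le_of_mem_dist (by linarith) ?_ ?_
  · intro g hg
    have hgb := btw_of_seg hγ hg
    suffices H : ∃ i < k, ∃ y ∈ segImg (f i) (p i) (p (i + 1)), dist g y ≤ l + 4 * δ by
      obtain ⟨i, hi, y, hy, hd⟩ := H
      exact ⟨y, by simp only [Set.mem_iUnion, Finset.mem_range]; exact ⟨i, hi, hy⟩, hd⟩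
    have spec : ∀ i < k, ∀ r, r + δ ≤ l + 4 * δ → Nr r g (p i) (p (i+1)) →
        ∃ i < k, ∃ y ∈ segImg (f i) (p i) (p (i + 1)), dist g y ≤ l + 4 * δ := by
      rintro i hi r hr ⟨q, hq, hd⟩
      obtain ⟨e, he⟩ := hgeo (p (i+1)) (p (i+1))
      obtain ⟨z, hz, hd'⟩ := slim_spec hgeo hslim hq (hf i hi) he
      have := dist_triangle g q z
      rcases hz with hz | hz
      · exact ⟨i, hi, z, hz, by linarith⟩
      · have hb := btw_of_seg he hz
        have : z = p (i+1) := by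
          unfold Btw3 at hb
          rw [dist_self] at hb
          have n1 : 0 ≤ dist (p (i+1)) z := dist_nonneg
          have n2 : 0 ≤ dist z (p (i+1)) := dist_nonneg
          exact dist_eq_zero.1 (by linarith)
        subst this
        exact ⟨i, hi, _, end_mem (hf i hi), by linarith⟩
    by_cases hlast : Nr δ g (p k) (p k)
    · obtain ⟨j, rfl⟩ : ∃ j, k = j + 1 := ⟨k - 1, by omega⟩
      have := hlast.gp
      rw [dist_self] at this
      exact ⟨j, by omega, p (j+1), end_mem (hf j (by omega)), by linarith⟩
    obtain ⟨i, hi, hPE, hQE⟩ : ∃ i < k, Nr δ g (p i) (p k) ∧ ¬ Nr δ g (p (i+1)) (p k) := by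
      by_contra hcon
      push Not at hcon
      have : ∀ i ≤ k, Nr δ g (p i) (p k) := by
        intro i
        induction i with
        | zero => intro _; exact ⟨g, hgb, by simpa using hδ⟩
        | succ i ih => intro hi; exact hcon i (by omega) (ih (by omega))
      exact hlast (this k le_rfl)
    by_cases hik : i + 1 = k
    · rw [← hik] at hPE
      exact spec i hi δ (by linarith) hPE
    have hi2 : i + 1 < k := by omega
    have hg0 : Nr 0 g (p 0) (p k) := ⟨g, hgb, by simp⟩
    have hSQ : Nr δ g (p 0) (p (i+1)) := by
      rcases hg0.step hgeo hslim (p (i+1)) with h | h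
      · exact h.mono (by linarith)
      · exact absurd (h.mono (by linarith)) hQE
    rcases hSQ.step hgeo hslim (p i) with hSP | h
    swap
    · exact spec i hi _ (by linarith) h
    rcases hPE.step hgeo hslim (p (i+2)) with h | hRE
    · obtain ⟨q, hq, hqd⟩ := h
      obtain ⟨h1, h2⟩ := (hf (i+1) hi2).rev
      obtain ⟨z, hz, hd⟩ := slim_spec hgeo hslim hq (hf i hi) h1
      have := dist_triangle g q z
      rcases hz with hz | hz
      · exact ⟨i, hi, z, hz, by linarith⟩
      · rw [h2] at hz
        exact ⟨i+1, hi2, z, hz, by linarith⟩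
    · exfalso
      have L1 := hlen i hi
      have L2 := hlen (i+1) hi2
      have C := hc i hi2
      have e1 := dist_comm (p (i+1)) (p i)
      have e2 := dist_comm (p (i+2)) (p (i+1))
      have e3 := dist_comm (p (i+2)) (p i)
      have e4 := dist_comm (p i) (p 0)
      have hSR : dist (p i) (p 0) + dist (p i) (p (i+2)) - dist (p 0) (p (i+2))
          ≤ 2 * (l + 4 * δ) := by
        rcases (hA i hi).step hgeo hslim (p (i+2)) with h | h
        · linarith [h.gp]
        · have := h.gp
          linarith
      have hPE' : dist (p (i+2)) (p i) + dist (p (i+2)) (p k) - dist (p i) (p k)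
          ≤ 2 * (l + 4 * δ) := by
        rcases (hB (i+1) hi2).step hgeo hslim (p i) with h | h
        · have := h.gp
          simp only [show i + 1 + 1 = i + 2 from rfl] at *
          linarith
        · have := h.gp
          simp only [show i + 1 + 1 = i + 2 from rfl] at *
          linarith
      obtain ⟨s, hs, hsd⟩ := hSP
      obtain ⟨e, he, hed⟩ := hRE
      unfold Btw3 at hs he
      simp only [show i + 1 + 1 = i + 2 from rfl] at *
      have a1 := dist_triangle (p 0) s (p (i+2))
      have a2 := dist_triangle (p i) e (p k)
      have a3 := dist_triangle s e (p (i+2))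
      have a4 := dist_triangle (p i) s e
      have a5 := dist_triangle s g e
      have b1 := dist_comm s g
      have b2 := dist_comm e (p (i+2))
      have b3 := dist_comm s (p i)
      linarith
  · intro x hx
    simp only [Set.mem_iUnion, Finset.mem_range] at hx
    obtain ⟨i, hi, hx⟩ := hx
    have hxb := btw_of_seg (hf i hi) hx
    have hL := hlen i hi
    have e1 := dist_comm (p (i+1)) (p i)
    have e5 := dist_comm (p (i+1)) (p k)
    have e6 := dist_comm (p i) (p k)
    obtain ⟨R, hQ, hR⟩ : ∃ R, dist (p (i+1)) (p i) + dist (p (i+1)) R - dist (p i) R ≤ 2 * l ∧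
        (R = p k ∨ (2 * l + 8 * δ < dist (p (i+1)) R ∧
          dist R (p (i+1)) + dist R (p k) - dist (p (i+1)) (p k) ≤ 2 * l + 6 * δ)) := by
      by_cases hik : i + 1 = k
      · refine ⟨p k, ?_, Or.inl rfl⟩
        rw [← hik, dist_self]; linarith
      · refine ⟨p (i+2), hc i (by omega), Or.inr ⟨hlen (i+1) (by omega), ?_⟩⟩
        have := (hB (i+1) (by omega)).gp
        simp only [show i + 1 + 1 = i + 2 from rfl] at *
        linarith
    obtain ⟨O, hP, hO⟩ : ∃ O, dist (p i) (p (i+1)) + dist (p i) O - dist (p (i+1)) O ≤ 2 * l ∧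
        (O = p 0 ∨ (2 * l + 8 * δ < dist (p i) O ∧
          dist O (p i) + dist O (p 0) - dist (p i) (p 0) ≤ 2 * l + 6 * δ)) := by
      rcases i with _ | j
      · refine ⟨p 0, ?_, Or.inl rfl⟩
        rw [dist_self]; linarith
      · have h1 := hc j hi
        have h2 := hlen j (by omega)
        have h3 := (hA j (by omega)).gp
        simp only [show j + 1 + 1 = j + 2 from rfl] at *
        have := dist_comm (p (j+1)) (p j)
        have := dist_comm (p (j+2)) (p j)
        have := dist_comm (p (j+1)) (p 0)
        refine ⟨p j, by linarith, Or.inr ⟨by linarith, by linarith⟩⟩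
    obtain ⟨z, hz, hd⟩ := seg_near hδ hl hgeo hslim hγ hxb hL (by linarith [(hA i hi).gp])
      (by linarith [(hB i hi).gp]) hP hQ hR hO
    exact ⟨z, hz, hd⟩
end

section
/- Under the hypotheses of the local-to-global geodesic approximation lemma (S ⊆ Γ an (R/4)-connected set in a proper δ-hyperbolic space with local geodesics γ_s satisfying S ∩ B_R(s) ⊆ N_H(γ_s) and γ_s ∩ B_R(s) ⊆ N_H(S), with R > 24H + 16δ), the resulting global geodesic γ can be oriented so that for every s ∈ S, the geodesic γ_s can be oriented with Gromov products ⟨γ^{+∞}, γ_s^{+∞}⟩_s and ⟨γ^{−∞}, γ_s^{−∞}⟩_s both at least R − (4H + 10δ). -/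
open Metric Set Filter

/-- `S` is `r`-connected: any two points of `S` are joined by a finite chain in `S`
with consecutive distances at most `r`. -/
def IsRConnected {M : Type*} [MetricSpace M] (r : ℝ) (S : Set M) : Prop :=
  ∀ p ∈ S, ∀ q ∈ S, ∃ (n : ℕ) (c : ℕ → M), c 0 = p ∧ c n = q ∧
    (∀ i ≤ n, c i ∈ S) ∧ ∀ i < n, dist (c i) (c (i + 1)) ≤ r

section helpers
variable {X : Type*} [MetricSpace X]

lemma geod_sub {f : ℝ → X} {s t : ℝ}
    (h : ∀ p ∈ uIcc s t, ∀ q ∈ uIcc s t, dist (f p) (f q) = |p - q|) :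
    ∃ g, IsGeodSeg g (f s) (f t) ∧ segImg g (f s) (f t) ⊆ f '' uIcc s t := by
  have hd : dist (f s) (f t) = |s - t| := h s left_mem_uIcc t right_mem_uIcc
  rcases le_total s t with hst | hst
  · have hd' : dist (f s) (f t) = t - s := by rw [hd, abs_sub_comm, abs_of_nonneg]; linarith
    rw [uIcc_of_le hst] at *
    refine ⟨fun r => f (s + r), ⟨by simp, by simp [hd'], ?_⟩, ?_⟩
    · rw [hd']
      intro p hp q hq
      rw [h (s + p) ⟨by linarith [hp.1], by linarith [hp.2]⟩ (s + q)
        ⟨by linarith [hq.1], by linarith [hq.2]⟩]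
      congr 1; ring
    · rintro _ ⟨r, hr, rfl⟩
      rw [hd'] at hr
      exact ⟨s + r, ⟨by linarith [hr.1], by linarith [hr.2]⟩, rfl⟩
  · have hd' : dist (f s) (f t) = s - t := by rw [hd, abs_of_nonneg]; linarith
    rw [uIcc_of_ge hst] at *
    refine ⟨fun r => f (s - r), ⟨by simp, by simp [hd'], ?_⟩, ?_⟩
    · rw [hd']
      intro p hp q hq
      rw [h (s - p) ⟨by linarith [hp.2], by linarith [hp.1]⟩ (s - q)
        ⟨by linarith [hq.2], by linarith [hq.1]⟩, abs_sub_comm]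
      congr 1; ring
    · rintro _ ⟨r, hr, rfl⟩
      rw [hd'] at hr
      exact ⟨s - r, ⟨by linarith [hr.2], by linarith [hr.1]⟩, rfl⟩

lemma geod_sub_mem {f : ℝ → X} {s t v : ℝ} (hf : Isometry f) (h1 : s ≤ v) (h2 : v ≤ t) :
    ∃ g, IsGeodSeg g (f s) (f t) ∧ f v ∈ segImg g (f s) (f t) := by
  have hd' : dist (f s) (f t) = t - s := by
    rw [hf.dist_eq, Real.dist_eq, abs_sub_comm, abs_of_nonneg]; linarith
  refine ⟨fun r => f (s + r), ⟨by simp, by simp [hd'], ?_⟩, ?_⟩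
  · intro p hp q hq
    simp [hf.dist_eq, Real.dist_eq]
  · refine ⟨v - s, ?_, by simp⟩
    rw [hd']; constructor <;> linarith

def GConv (G : Set X) : Prop := ∀ a ∈ G, ∀ b ∈ G, ∃ g, IsGeodSeg g a b ∧ segImg g a b ⊆ G

lemma gconv_image {f : ℝ → X} {I : Set ℝ} (hI : I.OrdConnected)
    (h : ∀ p ∈ I, ∀ q ∈ I, dist (f p) (f q) = |p - q|) : GConv (f '' I) := by
  rintro _ ⟨s, hs, rfl⟩ _ ⟨t, ht, rfl⟩
  have hsub : uIcc s t ⊆ I := hI.uIcc_subset hs ht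
  obtain ⟨g, hg, hg'⟩ := geod_sub (f := f) (s := s) (t := t)
    (fun p hp q hq => h p (hsub hp) q (hsub hq))
  exact ⟨g, hg, hg'.trans (image_mono hsub)⟩

lemma seg_between {f : ℝ → X} {x y q : X} (h : IsGeodSeg f x y) (hq : q ∈ segImg f x y) :
    dist x q + dist q y = dist x y := by
  obtain ⟨r, hr, rfl⟩ := hq
  have e1 := h.2.2 0 ⟨le_refl _, dist_nonneg⟩ r hr
  have e2 := h.2.2 r hr (dist x y) ⟨dist_nonneg, le_refl _⟩
  rw [h.1] at e1
  rw [h.2.1] at e2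
  have h1 : 0 - r ≤ 0 := by linarith [hr.1]
  have h2 : r - dist x y ≤ 0 := by linarith [hr.2]
  rw [e1, e2, abs_of_nonpos h1, abs_of_nonpos h2]
  ring

lemma quad {δ : ℝ} (hgeo : GeodesicSpace X) (hslim : SlimTriangles X δ)
    {a b a' b' p : X} {f g : ℝ → X} (hf : IsGeodSeg f a b) (hg : IsGeodSeg g b' a')
    (hp : p ∈ segImg f a b) (hδ : 0 ≤ δ) :
    ∃ q, dist p q ≤ 2 * δ ∧ (q ∈ segImg g b' a' ∨ dist a q + dist q a' = dist a a' ∨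
      dist b q + dist q b' = dist b b') := by
  obtain ⟨f1, h1⟩ := hgeo b b'
  obtain ⟨f2, h2⟩ := hgeo a b'
  obtain ⟨f3, h3⟩ := hgeo a a'
  obtain ⟨q, hq, hpq⟩ := hslim a b b' f f1 f2 hf h1 h2 p hp
  rcases hq with hq | hq
  · exact ⟨q, by linarith, Or.inr (Or.inr (seg_between h1 hq))⟩
  · obtain ⟨q', hq', hqq⟩ := hslim a b' a' f2 g f3 h2 hg h3 q hq
    refine ⟨q', by linarith [dist_triangle p q q'], ?_⟩
    rcases hq' with hq' | hq'
    · exact Or.inl hq'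
    · exact Or.inr (Or.inl (seg_between h3 hq'))

/-- one bootstrapping step -/
lemma boot1 {δ : ℝ} (hδ : 0 ≤ δ) (hgeo : GeodesicSpace X) (hslim : SlimTriangles X δ)
    {G : Set X} (hG : GConv G) {g : ℝ → X} (hg : Isometry g) {u L E : ℝ} (hL : 0 ≤ L)
    (ha : ∃ e ∈ G, dist (g (u - L)) e ≤ E) (hb : ∃ e ∈ G, dist (g (u + L)) e ≤ E) :
    ∃ e ∈ G, dist (g u) e ≤ max (2 * δ) (E - L + 4 * δ) := by
  obtain ⟨a', ha', hda⟩ := ha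
  obtain ⟨b', hb', hdb⟩ := hb
  obtain ⟨h, hh, hhG⟩ := hG b' hb' a' ha'
  obtain ⟨f, hf, hfm⟩ := geod_sub_mem (f := g) (s := u - L) (t := u + L) (v := u) hg
    (by linarith) (by linarith)
  have d1 : dist (g (u - L)) (g u) = L := by
    rw [hg.dist_eq, Real.dist_eq, abs_sub_comm, abs_of_nonneg] <;> linarith
  have d2 : dist (g (u + L)) (g u) = L := by
    rw [hg.dist_eq, Real.dist_eq, abs_of_nonneg] <;> linarith
  obtain ⟨q, hq, hc | hc | hc⟩ := quad hgeo hslim hf hh hfm hδ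
  · exact ⟨q, hhG hc, le_max_of_le_left hq⟩
  · refine ⟨a', ha', le_max_of_le_right ?_⟩
    linarith [dist_triangle (g u) q a', dist_triangle (g (u - L)) q (g u), dist_comm (g u) q]
  · refine ⟨b', hb', le_max_of_le_right ?_⟩
    linarith [dist_triangle (g u) q b', dist_triangle (g (u + L)) q (g u), dist_comm (g u) q]

/-- bootstrapping: bounded distance implies small distance -/
lemma boot {δ H L K : ℝ} (hδ : 0 ≤ δ) (hgeo : GeodesicSpace X) (hslim : SlimTriangles X δ)
    (hH : 0 ≤ H) (hL0 : 0 ≤ L) (hL : H + K + 4 * δ < L)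
    {G : Set X} (hG : GConv G) {T : Set X}
    (hT : ∀ x ∈ T, x ∈ G ∨ ∃ (g : ℝ → X) (u : ℝ), Isometry g ∧ dist x (g u) ≤ H ∧
      (∃ a ∈ T, dist a (g (u - L)) ≤ K) ∧ (∃ b ∈ T, dist b (g (u + L)) ≤ K))
    (hbd : ∃ D, ∀ x ∈ T, ∃ e ∈ G, dist x e ≤ D) :
    ∀ x ∈ T, ∃ e ∈ G, dist x e ≤ H + 2 * δ := by
  obtain ⟨D, hD⟩ := hbd
  have key : ∀ n : ℕ, ∀ x ∈ T, ∃ e ∈ G,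
      dist x e ≤ max (H + 2 * δ) (D - n * (L - (H + K + 4 * δ))) := by
    intro n
    induction n with
    | zero =>
      intro x hx
      obtain ⟨e, he, h⟩ := hD x hx
      exact ⟨e, he, le_max_of_le_right (by simpa using h)⟩
    | succ n ih =>
      intro x hx
      rcases hT x hx with hxG | ⟨g, u, hg, hxu, ⟨a, ha, haK⟩, ⟨b, hb, hbK⟩⟩
      · exact ⟨x, hxG, le_max_of_le_left (by rw [dist_self]; linarith)⟩
      · obtain ⟨a', ha', hda⟩ := ih a ha
        obtain ⟨b', hb', hdb⟩ := ih b hb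
        set M := max (H + 2 * δ) (D - n * (L - (H + K + 4 * δ))) with hM
        obtain ⟨e, he, hde⟩ := boot1 hδ hgeo hslim hG hg (u := u) (L := L) (E := K + M) hL0
          ⟨a', ha', by linarith [dist_triangle (g (u - L)) a a', dist_comm (g (u - L)) a]⟩
          ⟨b', hb', by linarith [dist_triangle (g (u + L)) b b', dist_comm (g (u + L)) b]⟩
        refine ⟨e, he, ?_⟩
        have h1 := dist_triangle x (g u) e
        push_cast
        rcases max_cases (2 * δ) (K + M - L + 4 * δ) with h2 | h2
        · exact le_max_of_le_left (by linarith)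
        · rcases max_cases (H + 2 * δ) (D - n * (L - (H + K + 4 * δ))) with h3 | h3
          · exact le_max_of_le_left (by linarith)
          · exact le_max_of_le_right (by linarith)
  obtain ⟨n, hn⟩ := exists_nat_gt ((D - (H + 2 * δ)) / (L - (H + K + 4 * δ)))
  rw [div_lt_iff₀ (by linarith)] at hn
  intro x hx
  obtain ⟨e, he, h⟩ := key n x hx
  refine ⟨e, he, h.trans (max_le le_rfl (by linarith))⟩

lemma ultra_lim {Y : Type*} [TopologicalSpace Y] (φ : Ultrafilter ℕ) {K : Set Y}
    (hK : IsCompact K) {g : ℕ → Y} (h : ∀ᶠ n in (φ : Filter ℕ), g n ∈ K) :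
    ∃ l ∈ K, Tendsto g φ (nhds l) := by
  have := hK.ultrafilter_le_nhds (φ.map g) (by
    rw [le_principal_iff]; exact h)
  exact this

lemma limit_geod [ProperSpace X] (f : ℕ → ℝ → X) (J : ℕ → Set ℝ)
    (hJ : ∀ t, ∀ᶠ n in atTop, t ∈ J n)
    (hf : ∀ n, ∀ s ∈ J n, ∀ t ∈ J n, dist (f n s) (f n t) = |s - t|)
    (x0 : X) (C : ℝ) (h0 : ∀ n, dist (f n 0) x0 ≤ C) :
    ∃ γ : ℝ → X, Isometry γ ∧ ∀ x, (∀ᶠ n in atTop, ∃ t ∈ J n, dist x (f n t) ≤ C) →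
      ∃ t, dist x (γ t) ≤ C := by
  set φ : Ultrafilter ℕ := hyperfilter ℕ
  have hle : (φ : Filter ℕ) ≤ atTop := Nat.hyperfilter_le_atTop
  have hJ' : ∀ t, ∀ᶠ n in (φ : Filter ℕ), t ∈ J n := fun t => hle (hJ t)
  have hl : ∀ t, ∃ l, Tendsto (fun n => f n t) φ (nhds l) := by
    intro t
    obtain ⟨l, -, h⟩ := ultra_lim φ (isCompact_closedBall x0 (C + |t|)) (g := fun n => f n t) (by
      filter_upwards [hJ' t, hJ' 0] with n h1 h2
      have := hf n t h1 0 h2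
      rw [sub_zero] at this
      rw [mem_closedBall]
      linarith [dist_triangle (f n t) (f n 0) x0, h0 n])
    exact ⟨l, h⟩
  choose γ hγ using hl
  refine ⟨γ, ?_, ?_⟩
  · refine Isometry.of_dist_eq fun s t => ?_
    have h1 : Tendsto (fun n => dist (f n s) (f n t)) φ (nhds (dist (γ s) (γ t))) :=
      (hγ s).dist (hγ t)
    have h2 : Tendsto (fun n => dist (f n s) (f n t)) φ (nhds (dist s t)) := by
      refine tendsto_const_nhds.congr' ?_
      filter_upwards [hJ' s, hJ' t] with n a b
      rw [hf n s a t b, Real.dist_eq]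
    exact tendsto_nhds_unique h1 h2
  · intro x hx
    have hx' : ∀ n, ∃ t, (∃ t ∈ J n, dist x (f n t) ≤ C) → (t ∈ J n ∧ dist x (f n t) ≤ C) := by
      intro n
      by_cases h : ∃ t ∈ J n, dist x (f n t) ≤ C
      · obtain ⟨t, ht⟩ := h
        exact ⟨t, fun _ => ht⟩
      · exact ⟨0, fun h' => absurd h' h⟩
    choose τ hτ using hx'
    have hev : ∀ᶠ n in (φ : Filter ℕ), τ n ∈ J n ∧ dist x (f n (τ n)) ≤ C := by
      filter_upwards [hle hx] with n hn using hτ n hn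
    obtain ⟨T, -, hT⟩ := ultra_lim φ
      (isCompact_Icc (a := -(2 * C + dist x x0)) (b := 2 * C + dist x x0)) (g := τ) (by
      filter_upwards [hev, hJ' 0] with n h1 h2
      have h3 := hf n (τ n) h1.1 0 h2
      rw [sub_zero] at h3
      rw [mem_Icc, ← abs_le, ← h3]
      linarith [dist_triangle (f n (τ n)) x (f n 0), dist_triangle x x0 (f n 0), h0 n, h1.2,
        dist_comm x (f n (τ n)), dist_comm x0 (f n 0)])
    refine ⟨T, ?_⟩
    have hlim : Tendsto (fun n => C + |τ n - T| + dist (f n T) (γ T)) φ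
        (nhds (C + |T - T| + dist (γ T) (γ T))) :=
      (tendsto_const_nhds.add (hT.sub_const T).abs).add ((hγ T).dist tendsto_const_nhds)
    rw [sub_self, abs_zero, dist_self, add_zero, add_zero] at hlim
    refine ge_of_tendsto hlim ?_
    filter_upwards [hev, hJ' T] with n h1 h2
    have h3 := hf n _ h1.1 T h2
    linarith [dist_triangle x (f n (τ n)) (γ T), dist_triangle (f n (τ n)) (f n T) (γ T)]

end helpers

section chains
variable {X : Type*} [MetricSpace X]

lemma seg_gconv {h : ℝ → X} {x y : X} (hh : IsGeodSeg h x y) :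
    GConv (segImg h x y) ∧ x ∈ segImg h x y ∧ y ∈ segImg h x y :=
  ⟨gconv_image ordConnected_Icc hh.2.2, ⟨0, ⟨le_rfl, dist_nonneg⟩, hh.1⟩,
    ⟨dist x y, ⟨dist_nonneg, le_rfl⟩, hh.2.1⟩⟩

lemma fin_bd {T G : Set X} (hT : T.Finite) {e : X} (he : e ∈ G) :
    ∃ D, ∀ x ∈ T, ∃ e ∈ G, dist x e ≤ D := by
  obtain ⟨D, hD⟩ := (hT.image (fun x => dist x e)).bddAbove
  exact ⟨D, fun x hx => ⟨e, he, hD ⟨x, hx, rfl⟩⟩⟩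

structure Loc (δ H R : ℝ) (S : Set X) (g : X → ℝ → X) (U : X → ℝ) : Prop where
  hδ : 0 ≤ δ
  hH : 0 < H
  hR : 24 * H + 16 * δ < R
  geo : GeodesicSpace X
  slim : SlimTriangles X δ
  iso : ∀ s ∈ S, Isometry (g s)
  hU : ∀ s ∈ S, dist s (g s (U s)) < H
  hA : ∀ s ∈ S, ∀ t, |t - U s| ≤ R - H → ∃ c ∈ S, dist c (g s t) < H
  hB : ∀ s ∈ S, ∀ s' ∈ S, dist s' s < R → ∃ v, dist s' (g s v) < H

variable {δ H R : ℝ} {S : Set X} {g : X → ℝ → X} {U : X → ℝ}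

lemma Loc.next (hl : Loc δ H R S g U) {z : X} (hz : z ∈ S) {σ : ℝ} (hσ : σ = 1 ∨ σ = -1) :
    ∃ w : X × ℝ, w.1 ∈ S ∧ (w.2 = 1 ∨ w.2 = -1) ∧
      dist w.1 (g z (U z + σ * (2 * R / 3))) < H ∧
      dist z (g w.1 (U w.1 - w.2 * (2 * R / 3))) ≤ 5 * H := by
  have hH := hl.hH
  have hR := hl.hR
  have hδ := hl.hδ
  have hab : |σ * (2 * R / 3)| = 2 * R / 3 := by
    rw [abs_mul, abs_of_nonneg (show 0 ≤ 2 * R / 3 by linarith)]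
    rcases hσ with rfl | rfl <;> simp
  obtain ⟨z', hz', hd⟩ := hl.hA z hz (U z + σ * (2 * R / 3)) (by
    rw [add_sub_cancel_left, hab]; linarith)
  have hdd : dist (g z (U z)) (g z (U z + σ * (2 * R / 3))) = 2 * R / 3 := by
    rw [(hl.iso z hz).dist_eq, Real.dist_eq, abs_sub_comm, add_sub_cancel_left, hab]
  have hz1 := hl.hU z hz
  have hz2 := hl.hU z' hz'
  have t1 := dist_triangle4 z (g z (U z)) (g z (U z + σ * (2 * R / 3))) z'
  have t2 := dist_triangle4 (g z (U z)) z z' (g z (U z + σ * (2 * R / 3)))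
  rw [dist_comm (g z (U z + σ * (2 * R / 3))) z'] at t1
  rw [dist_comm (g z (U z)) z] at t2
  obtain ⟨v, hv⟩ := hl.hB z' hz' z hz (by linarith)
  have t3 := dist_triangle4 z (g z' v) (g z' (U z')) z'
  have t4 := dist_triangle4 (g z' v) z z' (g z' (U z'))
  rw [dist_comm (g z' (U z')) z'] at t3
  rw [dist_comm (g z' v) z] at t4
  rw [(hl.iso z' hz').dist_eq, Real.dist_eq] at t3 t4
  rcases le_total v (U z') with h | h
  · refine ⟨(z', 1), hz', Or.inl rfl, hd, ?_⟩
    rw [abs_of_nonpos (by linarith)] at t3 t4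
    have t5 := dist_triangle z (g z' v) (g z' (U z' - 1 * (2 * R / 3)))
    rw [(hl.iso z' hz').dist_eq, Real.dist_eq] at t5
    have : |v - (U z' - 1 * (2 * R / 3))| ≤ 4 * H := by
      rw [abs_le]; constructor <;> linarith
    show dist z (g z' (U z' - 1 * (2 * R / 3))) ≤ 5 * H
    linarith
  · refine ⟨(z', -1), hz', Or.inr rfl, hd, ?_⟩
    rw [abs_of_nonneg (by linarith)] at t3 t4
    have t5 := dist_triangle z (g z' v) (g z' (U z' - (-1) * (2 * R / 3)))
    rw [(hl.iso z' hz').dist_eq, Real.dist_eq] at t5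
    have : |v - (U z' - (-1) * (2 * R / 3))| ≤ 4 * H := by
      rw [abs_le]; constructor <;> linarith
    show dist z (g z' (U z' - (-1) * (2 * R / 3))) ≤ 5 * H
    linarith

structure Chain (H R : ℝ) (S : Set X) (g : X → ℝ → X) (U : X → ℝ) (P : ℕ → X) (σ : ℕ → ℝ) :
    Prop where
  mem : ∀ k, P k ∈ S
  sg : ∀ k, σ k = 1 ∨ σ k = -1
  fw : ∀ k, dist (P (k + 1)) (g (P k) (U (P k) + σ k * (2 * R / 3))) < H
  bw : ∀ k, dist (P k) (g (P (k + 1)) (U (P (k + 1)) - σ (k + 1) * (2 * R / 3))) ≤ 5 * H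

lemma Loc.chain (hl : Loc δ H R S g U) {z : X} (hz : z ∈ S) {σ : ℝ} (hσ : σ = 1 ∨ σ = -1) :
    ∃ P τ, Chain H R S g U P τ ∧ P 0 = z ∧ τ 0 = σ := by
  have hn : ∀ p : {p : X × ℝ // p.1 ∈ S ∧ (p.2 = 1 ∨ p.2 = -1)},
      ∃ q : {p : X × ℝ // p.1 ∈ S ∧ (p.2 = 1 ∨ p.2 = -1)},
        dist q.1.1 (g p.1.1 (U p.1.1 + p.1.2 * (2 * R / 3))) < H ∧
      dist p.1.1 (g q.1.1 (U q.1.1 - q.1.2 * (2 * R / 3))) ≤ 5 * H := by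
    intro p
    obtain ⟨w, h1, h2, h3⟩ := hl.next p.2.1 p.2.2
    exact ⟨⟨w, h1, h2⟩, h3⟩
  choose F hF using hn
  let Q : ℕ → {p : X × ℝ // p.1 ∈ S ∧ (p.2 = 1 ∨ p.2 = -1)} :=
    fun n => Nat.rec ⟨(z, σ), hz, hσ⟩ (fun _ p => F p) n
  exact ⟨fun n => (Q n).1.1, fun n => (Q n).1.2,
    ⟨fun k => (Q k).2.1, fun k => (Q k).2.2, fun k => (hF (Q k)).1, fun k => (hF (Q k)).2⟩,
    rfl, rfl⟩

lemma Chain.nb {P : ℕ → X} {σ : ℕ → ℝ} (hc : Chain H R S g U P σ) (hH : 0 < H) (k : ℕ)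
    {T : Set X} (h1 : P k ∈ T) (h2 : P (k + 2) ∈ T) :
    (∃ a ∈ T, dist a (g (P (k + 1)) (U (P (k + 1)) - 2 * R / 3)) ≤ 5 * H) ∧
    (∃ a ∈ T, dist a (g (P (k + 1)) (U (P (k + 1)) + 2 * R / 3)) ≤ 5 * H) := by
  have f := hc.fw (k + 1)
  have b := hc.bw k
  rcases hc.sg (k + 1) with h | h
  · rw [h, one_mul] at f b
    exact ⟨⟨_, h1, b⟩, ⟨_, h2, by linarith⟩⟩
  · rw [h, neg_one_mul] at f b
    rw [← sub_eq_add_neg] at f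
    rw [sub_neg_eq_add] at b
    exact ⟨⟨_, h2, by linarith⟩, ⟨_, h1, b⟩⟩

lemma Chain.growth {P : ℕ → X} {σ : ℕ → ℝ} (hc : Chain H R S g U P σ) (hl : Loc δ H R S g U)
    (n : ℕ) : n * (2 * R / 3 - 4 * H - 4 * δ) ≤ dist (P 0) (P n) := by
  have hH := hl.hH
  have hR := hl.hR
  have hδ := hl.hδ
  induction n with
  | zero => simp
  | succ n ih =>
    obtain ⟨h, hh⟩ := hl.geo (P 0) (P (n + 1))
    obtain ⟨hG, hx, hy⟩ := seg_gconv hh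
    have hb := boot (K := 5 * H) (L := 2 * R / 3) (H := H) hδ hl.geo hl.slim hH.le (by linarith)
      (by linarith) hG (T := P '' Iic (n + 1)) (by
        rintro _ ⟨k, hk, rfl⟩
        rw [mem_Iic] at hk
        rcases Nat.eq_zero_or_pos k with rfl | hk0
        · exact Or.inl hx
        rcases hk.eq_or_lt with rfl | hk1
        · exact Or.inl hy
        right
        obtain ⟨j, rfl⟩ : ∃ j, k = j + 1 := ⟨k - 1, by omega⟩
        exact ⟨g (P (j + 1)), U (P (j + 1)), hl.iso _ (hc.mem _), (hl.hU _ (hc.mem _)).le,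
          hc.nb hH j ⟨j, by simp; omega, rfl⟩ ⟨j + 2, by simp; omega, rfl⟩⟩)
      (fin_bd ((finite_Iic _).image _) hx) (P n) ⟨n, by simp, rfl⟩
    obtain ⟨e, he, hd⟩ := hb
    have h1 := seg_between hh he
    have h2 := hc.fw n
    have h3 := hl.hU (P n) (hc.mem n)
    have h4 : dist (g (P n) (U (P n))) (g (P n) (U (P n) + σ n * (2 * R / 3))) = 2 * R / 3 := by
      rw [(hl.iso _ (hc.mem n)).dist_eq, Real.dist_eq, abs_sub_comm, add_sub_cancel_left,
        abs_mul, abs_of_nonneg (show 0 ≤ 2 * R / 3 by linarith)]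
      rcases hc.sg n with h | h <;> simp [h]
    have t2 := dist_triangle4 (g (P n) (U (P n))) (P n) (P (n + 1))
      (g (P n) (U (P n) + σ n * (2 * R / 3)))
    rw [dist_comm _ (P n)] at t2
    have t3 := dist_triangle (P n) e (P (n + 1))
    have t4 := dist_triangle (P 0) e (P n)
    rw [dist_comm e] at t4
    push_cast
    linarith

/-- existence of a geodesic at bounded distance -/
lemma Loc.exists_line [ProperSpace X] (hl : Loc δ H R S g U) (hS : S.Nonempty)
    (hconn : IsRConnected (R / 4) S) :
    ∃ γ : ℝ → X, Isometry γ ∧ ∃ D, ∀ s ∈ S, ∃ e ∈ range γ, dist s e ≤ D := by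
  have hH := hl.hH
  have hR := hl.hR
  have hδ := hl.hδ
  obtain ⟨x0, hx0⟩ := hS
  obtain ⟨P, σ, hP, hP0, hσ0⟩ := hl.chain hx0 (σ := 1) (Or.inl rfl)
  obtain ⟨N, τ, hN, hN0, hτ0⟩ := hl.chain hx0 (σ := -1) (Or.inr rfl)
  have nb0 : ∀ T : Set X, P 1 ∈ T → N 1 ∈ T →
      (∃ a ∈ T, dist a (g x0 (U x0 - 2 * R / 3)) ≤ 5 * H) ∧
      (∃ a ∈ T, dist a (g x0 (U x0 + 2 * R / 3)) ≤ 5 * H) := by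
    intro T h1 h2
    have f1 := hP.fw 0
    have f2 := hN.fw 0
    rw [hP0, hσ0, one_mul] at f1
    rw [hN0, hτ0, neg_one_mul, ← sub_eq_add_neg] at f2
    exact ⟨⟨_, h2, by simp only [zero_add] at f2; linarith⟩,
      ⟨_, h1, by simp only [zero_add] at f1; linarith⟩⟩
  have hseg : ∀ n, ∃ h, IsGeodSeg h (N n) (P n) := fun n => hl.geo _ _
  choose h hh using hseg
  have hnear : ∀ n, ∀ x ∈ P '' Iic n ∪ N '' Iic n, ∃ e ∈ segImg (h n) (N n) (P n),
      dist x e ≤ H + 2 * δ := by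
    intro n
    obtain ⟨hG, hx, hy⟩ := seg_gconv (hh n)
    refine boot (K := 5 * H) (L := 2 * R / 3) (H := H) hδ hl.geo hl.slim hH.le (by linarith)
      (by linarith) hG ?_ (fin_bd (((finite_Iic _).image _).union ((finite_Iic _).image _)) hx)
    rcases Nat.eq_zero_or_pos n with rfl | hn
    · rintro x (⟨k, hk, rfl⟩ | ⟨k, hk, rfl⟩)
      · obtain rfl : k = 0 := by simpa using hk
        exact Or.inl hy
      · obtain rfl : k = 0 := by simpa using hk
        exact Or.inl hx
    have z0 : ∃ (f : ℝ → X) (u : ℝ), Isometry f ∧ dist x0 (f u) ≤ H ∧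
      (∃ a ∈ P '' Iic n ∪ N '' Iic n, dist a (f (u - 2 * R / 3)) ≤ 5 * H) ∧
      (∃ b ∈ P '' Iic n ∪ N '' Iic n, dist b (f (u + 2 * R / 3)) ≤ 5 * H) :=
      ⟨g x0, U x0, hl.iso _ hx0, (hl.hU _ hx0).le,
        nb0 _ (Or.inl ⟨1, hn, rfl⟩) (Or.inr ⟨1, hn, rfl⟩)⟩
    rintro x (⟨k, hk, rfl⟩ | ⟨k, hk, rfl⟩)
    · rw [mem_Iic] at hk
      rcases Nat.eq_zero_or_pos k with rfl | hk0
      · rw [hP0]; exact Or.inr z0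
      rcases hk.eq_or_lt with rfl | hk1
      · exact Or.inl hy
      right
      obtain ⟨j, rfl⟩ : ∃ j, k = j + 1 := ⟨k - 1, by omega⟩
      exact ⟨g (P (j + 1)), U (P (j + 1)), hl.iso _ (hP.mem _), (hl.hU _ (hP.mem _)).le,
        hP.nb hH j (Or.inl ⟨j, by simp; omega, rfl⟩) (Or.inl ⟨j + 2, by simp; omega, rfl⟩)⟩
    · rw [mem_Iic] at hk
      rcases Nat.eq_zero_or_pos k with rfl | hk0
      · rw [hN0]; exact Or.inr z0
      rcases hk.eq_or_lt with rfl | hk1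
      · exact Or.inl hx
      right
      obtain ⟨j, rfl⟩ : ∃ j, k = j + 1 := ⟨k - 1, by omega⟩
      exact ⟨g (N (j + 1)), U (N (j + 1)), hl.iso _ (hN.mem _), (hl.hU _ (hN.mem _)).le,
        hN.nb hH j (Or.inr ⟨j, by simp; omega, rfl⟩) (Or.inr ⟨j + 2, by simp; omega, rfl⟩)⟩
  have hfoot : ∀ n, ∃ t ∈ Icc 0 (dist (N n) (P n)), dist x0 (h n t) ≤ H + 2 * δ := by
    intro n
    obtain ⟨_, ⟨t, ht, rfl⟩, hd⟩ := hnear n x0 (Or.inl ⟨0, by simp, hP0⟩)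
    exact ⟨t, ht, hd⟩
  choose e he hde using hfoot
  have hc : 0 < 2 * R / 3 - 4 * H - 4 * δ := by linarith
  obtain ⟨γ, hγ, hlim⟩ := limit_geod (fun n t => h n (e n + t))
    (fun n => {t | e n + t ∈ Icc 0 (dist (N n) (P n))}) (by
      intro t
      obtain ⟨m, hm⟩ := exists_nat_gt ((|t| + H + 2 * δ) / (2 * R / 3 - 4 * H - 4 * δ))
      rw [div_lt_iff₀ hc] at hm
      filter_upwards [eventually_ge_atTop m] with n hn
      have hmn : (m : ℝ) * (2 * R / 3 - 4 * H - 4 * δ) ≤ n * (2 * R / 3 - 4 * H - 4 * δ) :=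
        mul_le_mul_of_nonneg_right (by exact_mod_cast hn) hc.le
      have g1 := hP.growth hl n
      have g2 := hN.growth hl n
      have q1 : dist (N n) (h n (e n)) = e n := by
        have := (hh n).2.2 0 ⟨le_rfl, dist_nonneg⟩ (e n) (he n)
        rw [(hh n).1] at this
        rw [this, abs_sub_comm, sub_zero, abs_of_nonneg (he n).1]
      have q2 := seg_between (hh n) ⟨e n, he n, rfl⟩
      rw [hP0] at g1
      rw [hN0] at g2
      have t1 := dist_triangle x0 (h n (e n)) (P n)
      have t2 := dist_triangle x0 (h n (e n)) (N n)
      rw [dist_comm (h n (e n)) (N n)] at t2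
      have := hde n
      have a1 := neg_abs_le t
      have a2 := le_abs_self t
      show e n + t ∈ Icc 0 (dist (N n) (P n))
      constructor <;> linarith)
    (by
      intro n s hs t ht
      have := (hh n).2.2 _ hs _ ht
      rw [this]; congr 1; ring)
    x0 (H + 2 * δ) (fun n => by
      simp only [add_zero]; rw [dist_comm]; exact hde n)
  set T : Set X := range P ∪ range N with hT
  have hTS : T ⊆ S := by
    rintro _ (⟨k, rfl⟩ | ⟨k, rfl⟩)
    · exact hP.mem k
    · exact hN.mem k
  have hTn : ∀ z ∈ T, (∃ a ∈ T, dist a (g z (U z - 2 * R / 3)) ≤ 5 * H) ∧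
      (∃ a ∈ T, dist a (g z (U z + 2 * R / 3)) ≤ 5 * H) := by
    have m1 : ∀ k, P k ∈ T := fun k => Or.inl ⟨k, rfl⟩
    have m2 : ∀ k, N k ∈ T := fun k => Or.inr ⟨k, rfl⟩
    rintro _ (⟨k, rfl⟩ | ⟨k, rfl⟩)
    · rcases k with _ | k
      · rw [hP0]; exact nb0 T (m1 1) (m2 1)
      · exact hP.nb hH k (m1 _) (m1 _)
    · rcases k with _ | k
      · rw [hN0]; exact nb0 T (m1 1) (m2 1)
      · exact hN.nb hH k (m2 _) (m2 _)
  have hTγ : ∀ z ∈ T, ∃ t, dist z (γ t) ≤ H + 2 * δ := by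
    intro z hz
    apply hlim
    obtain ⟨k, hk⟩ : ∃ k, ∀ n ≥ k, z ∈ P '' Iic n ∪ N '' Iic n := by
      rcases hz with ⟨k, rfl⟩ | ⟨k, rfl⟩
      · exact ⟨k, fun n hn => Or.inl ⟨k, hn, rfl⟩⟩
      · exact ⟨k, fun n hn => Or.inr ⟨k, hn, rfl⟩⟩
    filter_upwards [eventually_ge_atTop k] with n hn
    obtain ⟨_, ⟨t, ht, rfl⟩, hd⟩ := hnear n z (hk n hn)
    exact ⟨t - e n, by simpa using ht, by simpa using hd⟩
  have hstep : ∀ s ∈ S, ∀ s' ∈ S, dist s s' ≤ R / 4 → (∃ z ∈ T, dist s z ≤ R / 2) →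
      ∃ z ∈ T, dist s' z ≤ R / 2 := by
    rintro s hs s' hs' hss ⟨z, hz, hd⟩
    have hzS := hTS hz
    have t1 := dist_triangle s' s z
    rw [dist_comm s' s] at t1
    obtain ⟨v, hv⟩ := hl.hB z hzS s' hs' (by linarith)
    have hzu := hl.hU z hzS
    have t2 := dist_triangle4 (g z v) s' z (g z (U z))
    rw [dist_comm (g z v) s', (hl.iso z hzS).dist_eq, Real.dist_eq] at t2
    by_cases hcase : |v - U z| ≤ R / 2 - 2 * H
    · refine ⟨z, hz, ?_⟩
      have t3 := dist_triangle4 s' (g z v) (g z (U z)) z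
      rw [dist_comm (g z (U z)) z, (hl.iso z hzS).dist_eq, Real.dist_eq] at t3
      linarith
    · rw [not_le] at hcase
      obtain ⟨⟨a, ha, hda⟩, ⟨b, hb, hdb⟩⟩ := hTn z hz
      rcases le_total v (U z) with hvu | hvu
      · refine ⟨a, ha, ?_⟩
        rw [abs_of_nonpos (by linarith)] at hcase t2
        have t3 := dist_triangle4 s' (g z v) (g z (U z - 2 * R / 3)) a
        rw [dist_comm (g z (U z - 2 * R / 3)) a, (hl.iso z hzS).dist_eq, Real.dist_eq] at t3
        have : |v - (U z - 2 * R / 3)| ≤ R / 2 - 6 * H := by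
          rw [abs_le]; constructor <;> linarith
        linarith
      · refine ⟨b, hb, ?_⟩
        rw [abs_of_nonneg (by linarith)] at hcase t2
        have t3 := dist_triangle4 s' (g z v) (g z (U z + 2 * R / 3)) b
        rw [dist_comm (g z (U z + 2 * R / 3)) b, (hl.iso z hzS).dist_eq, Real.dist_eq] at t3
        have : |v - (U z + 2 * R / 3)| ≤ R / 2 - 6 * H := by
          rw [abs_le]; constructor <;> linarith
        linarith
  refine ⟨γ, hγ, R / 2 + (H + 2 * δ), ?_⟩
  intro s hs
  obtain ⟨n, c, hc0, hcn, hcS, hcd⟩ := hconn x0 hx0 s hs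
  have key : ∀ i ≤ n, ∃ z ∈ T, dist (c i) z ≤ R / 2 := by
    intro i
    induction i with
    | zero =>
      intro _
      exact ⟨x0, Or.inl ⟨0, hP0⟩, by rw [hc0, dist_self]; linarith⟩
    | succ i ih =>
      intro hi
      exact hstep (c i) (hcS i (by omega)) _ (hcS _ hi) (hcd i (by omega)) (ih (by omega))
  obtain ⟨z, hz, hd⟩ := key n le_rfl
  rw [hcn] at hd
  obtain ⟨t, ht⟩ := hTγ z hz
  exact ⟨γ t, ⟨t, rfl⟩, by linarith [dist_triangle s z (γ t)]⟩

end chains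

section final
variable {X : Type*} [MetricSpace X] {δ H R : ℝ} {S : Set X} {g : X → ℝ → X} {U : X → ℝ}

lemma line_gconv {γ : ℝ → X} (hγ : Isometry γ) : GConv (range γ) := by
  rw [← image_univ]
  exact gconv_image ordConnected_univ (fun p _ q _ => by rw [hγ.dist_eq, Real.dist_eq])

lemma Loc.near (hl : Loc δ H R S g U) {γ : ℝ → X} (hγ : Isometry γ)
    (hbd : ∃ D, ∀ s ∈ S, ∃ e ∈ range γ, dist s e ≤ D) :
    ∀ s ∈ S, ∃ w, dist (g s (U s)) (γ w) ≤ 2 * δ := by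
  have hH := hl.hH
  have hR := hl.hR
  have hδ := hl.hδ
  have hG := line_gconv hγ
  have hnb : ∀ s ∈ S, (∃ a ∈ S, dist a (g s (U s - 2 * R / 3)) ≤ H) ∧
      (∃ b ∈ S, dist b (g s (U s + 2 * R / 3)) ≤ H) := by
    intro s hs
    obtain ⟨a, ha, hda⟩ := hl.hA s hs (U s - 2 * R / 3) (by
      rw [abs_of_nonpos] <;> linarith)
    obtain ⟨b, hb, hdb⟩ := hl.hA s hs (U s + 2 * R / 3) (by
      rw [abs_of_nonneg] <;> linarith)
    exact ⟨⟨a, ha, hda.le⟩, ⟨b, hb, hdb.le⟩⟩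
  have h1 := boot (K := H) (L := 2 * R / 3) (H := H) hδ hl.geo hl.slim hH.le (by linarith)
    (by linarith) hG (T := S) (fun s hs => Or.inr ⟨g s, U s, hl.iso s hs, (hl.hU s hs).le,
      hnb s hs⟩) hbd
  intro s hs
  obtain ⟨⟨a, ha, hda⟩, ⟨b, hb, hdb⟩⟩ := hnb s hs
  obtain ⟨a', ha', hda'⟩ := h1 a ha
  obtain ⟨b', hb', hdb'⟩ := h1 b hb
  obtain ⟨_, ⟨w, rfl⟩, hw⟩ := boot1 hδ hl.geo hl.slim hG (hl.iso s hs) (u := U s)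
    (L := 2 * R / 3) (E := 2 * H + 2 * δ) (by linarith)
    ⟨a', ha', by
      linarith [dist_triangle (g s (U s - 2 * R / 3)) a a',
        dist_comm (g s (U s - 2 * R / 3)) a]⟩
    ⟨b', hb', by
      linarith [dist_triangle (g s (U s + 2 * R / 3)) b b',
        dist_comm (g s (U s + 2 * R / 3)) b]⟩
  exact ⟨w, hw.trans (max_le le_rfl (by linarith))⟩

lemma Loc.foot (hl : Loc δ H R S g U) {γ : ℝ → X} {W : X → ℝ}
    (hW : ∀ s ∈ S, dist (g s (U s)) (γ (W s)) ≤ 2 * δ) {c a : X} (hc : c ∈ S)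
    (hca : dist c a < H) : dist (γ (W c)) a ≤ 2 * H + 2 * δ := by
  have h1 := hl.hU c hc
  have h2 := hW c hc
  have := dist_triangle4 (γ (W c)) (g c (U c)) c a
  rw [dist_comm (γ (W c)) (g c (U c)), dist_comm (g c (U c)) c] at this
  linarith

lemma Loc.sides (hl : Loc δ H R S g U) {γ : ℝ → X} (hγ : Isometry γ) {W : X → ℝ}
    (hW : ∀ s ∈ S, dist (g s (U s)) (γ (W s)) ≤ 2 * δ) {s : X} (hs : s ∈ S) :
    ∃ σ : ℝ, (σ = 1 ∨ σ = -1) ∧ ∃ c ∈ S, ∃ d ∈ S,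
      dist c (g s (U s + σ * (R - H))) < H ∧ dist d (g s (U s - σ * (R - H))) < H ∧
      W s + (R - 3 * H - 4 * δ) ≤ W c ∧ W d ≤ W s - (R - 3 * H - 4 * δ) := by
  have hH := hl.hH
  have hR := hl.hR
  have hδ := hl.hδ
  have hi := hl.iso s hs
  obtain ⟨c, hc, hdc⟩ := hl.hA s hs (U s + (R - H)) (by rw [abs_of_nonneg] <;> linarith)
  obtain ⟨d, hd, hdd⟩ := hl.hA s hs (U s - (R - H)) (by rw [abs_of_nonpos] <;> linarith)
  have fc := hl.foot hW hc hdc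
  have fd := hl.foot hW hd hdd
  have fs := hW s hs
  have d1 : dist (g s (U s)) (g s (U s + (R - H))) = R - H := by
    rw [hi.dist_eq, Real.dist_eq, abs_of_nonpos] <;> linarith
  have d2 : dist (g s (U s)) (g s (U s - (R - H))) = R - H := by
    rw [hi.dist_eq, Real.dist_eq, abs_of_nonneg] <;> linarith
  have d3 : dist (g s (U s + (R - H))) (g s (U s - (R - H))) = 2 * (R - H) := by
    rw [hi.dist_eq, Real.dist_eq, abs_of_nonneg] <;> linarith
  have e1 : dist (γ (W s)) (γ (W c)) = |W s - W c| := by rw [hγ.dist_eq, Real.dist_eq]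
  have e2 : dist (γ (W s)) (γ (W d)) = |W s - W d| := by rw [hγ.dist_eq, Real.dist_eq]
  have e3 : dist (γ (W c)) (γ (W d)) = |W c - W d| := by rw [hγ.dist_eq, Real.dist_eq]
  have c1 := dist_comm (γ (W s)) (g s (U s))
  have c2 := dist_comm (γ (W c)) (g s (U s + (R - H)))
  have c3 := dist_comm (γ (W d)) (g s (U s - (R - H)))
  have t1 := dist_triangle4 (g s (U s)) (γ (W s)) (γ (W c)) (g s (U s + (R - H)))
  have t2 := dist_triangle4 (g s (U s)) (γ (W s)) (γ (W d)) (g s (U s - (R - H)))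
  have t3 := dist_triangle4 (g s (U s + (R - H))) (γ (W c)) (γ (W d)) (g s (U s - (R - H)))
  have t4 := dist_triangle4 (γ (W s)) (g s (U s)) (g s (U s + (R - H))) (γ (W c))
  have t5 := dist_triangle4 (γ (W s)) (g s (U s)) (g s (U s - (R - H))) (γ (W d))
  rw [e1] at t1 t4
  rw [e2] at t2 t5
  rw [e3] at t3
  rcases abs_cases (W s - W c) with h1 | h1 <;> rcases abs_cases (W s - W d) with h2 | h2 <;>
    rcases abs_cases (W c - W d) with h3 | h3
  all_goals first
    | (exfalso; linarith)
    | exact ⟨1, Or.inl rfl, c, hc, d, hd, by rwa [one_mul], by rwa [one_mul], by linarith,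
        by linarith⟩
    | exact ⟨-1, Or.inr rfl, d, hd, c, hc, by rwa [neg_one_mul, ← sub_eq_add_neg],
        by rwa [neg_one_mul, sub_neg_eq_add], by linarith, by linarith⟩

lemma Loc.cover1 (hl : Loc δ H R S g U) {γ : ℝ → X} (hγ : Isometry γ) {s : X} (hs : s ∈ S)
    {w e₁ e₂ u₁ u₂ : ℝ} {c₁ c₂ : X} (h1 : e₁ ≤ w) (h2 : w ≤ e₂) (hu1 : |u₁ - U s| ≤ R - H)
    (hu2 : |u₂ - U s| ≤ R - H) (hc1 : c₁ ∈ S) (hc2 : c₂ ∈ S)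
    (hd1 : dist c₁ (g s u₁) < H) (hd2 : dist c₂ (g s u₂) < H)
    (hf1 : dist (γ e₁) (g s u₁) ≤ 2 * H + 2 * δ) (hf2 : dist (γ e₂) (g s u₂) ≤ 2 * H + 2 * δ) :
    ∃ x ∈ S, dist (γ w) x ≤ 3 * H + 4 * δ := by
  have hH := hl.hH
  have hδ := hl.hδ
  obtain ⟨f, hf, hfm⟩ := geod_sub_mem hγ h1 h2
  obtain ⟨k, hk, hks⟩ := geod_sub (f := g s) (s := u₂) (t := u₁)
    (fun p _ q _ => by rw [(hl.iso s hs).dist_eq, Real.dist_eq])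
  obtain ⟨q, hq, hc | hc | hc⟩ := quad hl.geo hl.slim hf hk hfm hδ
  · obtain ⟨u, hu, rfl⟩ := hks hc
    have hu' : |u - U s| ≤ R - H := by
      rw [abs_le] at hu1 hu2 ⊢
      rw [mem_uIcc] at hu
      rcases hu with hu | hu <;> constructor <;> linarith
    obtain ⟨c, hc, hd⟩ := hl.hA s hs u hu'
    exact ⟨c, hc, by linarith [dist_triangle (γ w) (g s u) c, dist_comm (g s u) c]⟩
  · refine ⟨c₁, hc1, ?_⟩
    have t := dist_triangle4 (γ w) q (g s u₁) c₁
    linarith [dist_comm (g s u₁) c₁, dist_nonneg (x := γ e₁) (y := q)]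
  · refine ⟨c₂, hc2, ?_⟩
    have t := dist_triangle4 (γ w) q (g s u₂) c₂
    linarith [dist_comm (g s u₂) c₂, dist_nonneg (x := γ e₂) (y := q)]

lemma Loc.cover (hl : Loc δ H R S g U) {γ : ℝ → X} (hγ : Isometry γ) {W : X → ℝ}
    (hW : ∀ s ∈ S, dist (g s (U s)) (γ (W s)) ≤ 2 * δ) (hS : S.Nonempty) (w : ℝ) :
    ∃ x ∈ S, dist (γ w) x ≤ 3 * H + 4 * δ := by
  have hH := hl.hH
  have hR := hl.hR
  have hδ := hl.hδ
  have key : ∀ n : ℕ, ∀ s ∈ S, |w - W s| ≤ n * (R - 3 * H - 4 * δ) →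
      ∃ x ∈ S, dist (γ w) x ≤ 3 * H + 4 * δ := by
    intro n
    induction n with
    | zero =>
      intro s hs h
      simp only [Nat.cast_zero, zero_mul] at h
      have : w = W s := by
        have := abs_nonpos_iff.1 h
        linarith
      refine ⟨s, hs, ?_⟩
      rw [this]
      have := hl.foot hW hs (a := s) (by rw [dist_self]; exact hH)
      linarith
    | succ n ih =>
      intro s hs h
      push_cast at h
      obtain ⟨σ, hσ, c, hc, d, hd, hca, hda, hWc, hWd⟩ := hl.sides hγ hW hs
      have hcf := hl.foot hW hc hca
      have hdf := hl.foot hW hd hda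
      have hsf : dist (γ (W s)) (g s (U s)) ≤ 2 * H + 2 * δ := by
        rw [dist_comm]; linarith [hW s hs]
      have hab : |σ * (R - H)| = R - H := by
        rw [abs_mul, abs_of_nonneg (show 0 ≤ R - H by linarith)]
        rcases hσ with rfl | rfl <;> simp
      have a0 : |U s - U s| ≤ R - H := by simp; linarith
      have a1 : |U s + σ * (R - H) - U s| ≤ R - H := by rw [add_sub_cancel_left, hab]
      have a2 : |U s - σ * (R - H) - U s| ≤ R - H := by
        rw [sub_sub_cancel_left, abs_neg, hab]
      rcases le_total (W s) w with hsw | hsw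
      · rcases le_total w (W c) with hwc | hwc
        · exact hl.cover1 hγ hs hsw hwc a0 a1 hs hc (hl.hU s hs) hca hsf hcf
        · apply ih c hc
          rw [abs_of_nonneg (by linarith)] at h ⊢
          linarith
      · rcases le_total (W d) w with hwd | hwd
        · exact hl.cover1 hγ hs hwd hsw a2 a0 hd hs hda (hl.hU s hs) hdf hsf
        · apply ih d hd
          rw [abs_of_nonpos (by linarith)] at h ⊢
          linarith
  obtain ⟨s, hs⟩ := hS
  obtain ⟨n, hn⟩ := exists_nat_gt (|w - W s| / (R - 3 * H - 4 * δ))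
  rw [div_lt_iff₀ (by linarith)] at hn
  exact key n s hs hn.le

lemma gp_bound {s y a e a' p q : X} (h1 : dist s y ≤ H) (h2 : dist y a = R - H)
    (h3 : dist y e ≤ 2 * δ) (h4 : dist a a' ≤ 2 * H + 2 * δ)
    (h5 : dist y q = dist y a + dist a q) (h6 : dist e p = dist e a' + dist a' p) :
    R - 4 * H - 4 * δ ≤ gp s p q := by
  unfold gp
  have t1 := dist_triangle4 p a' a q
  have t2 := dist_triangle y s q
  have t3 := dist_triangle4 e y s p
  have t4 := dist_triangle4 y e a' a
  linarith [dist_comm p a', dist_comm a' a, dist_comm y s, dist_comm e y, dist_comm s p,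
    dist_comm s q]

end final

/-- under the hypotheses of the local-to-global geodesic approximation
lemma, the global geodesic `γ` can be oriented so that for every `s ∈ S` the local
geodesic `γ_s` can be oriented (by a sign `σ`) so that the Gromov products at `s` of the
corresponding forward endpoints and of the corresponding backward endpoints (realized as
liminfs of Gromov products along the rays) are both at least `R − (4H + 10δ)`. -/
theorem stmt12 {Γ : Type*} [MetricSpace Γ] [ProperSpace Γ]
    (δ H R : ℝ) (hδ : 0 ≤ δ) (hH : 0 < H) (hR : 24 * H + 16 * δ < R)
    (hgeo : GeodesicSpace Γ) (hslim : SlimTriangles Γ δ)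
    (S : Set Γ) (hSne : S.Nonempty) (hconn : IsRConnected (R / 4) S)
    (γloc : Γ → ℝ → Γ)
    (hloc : ∀ s ∈ S, Isometry (γloc s) ∧
      S ∩ Metric.ball s R ⊆ Metric.thickening H (Set.range (γloc s)) ∧
      Set.range (γloc s) ∩ Metric.ball s R ⊆ Metric.thickening H S) :
    ∃ γ : ℝ → Γ, Isometry γ ∧
      Metric.hausdorffDist (Set.range γ) S ≤ 3 * H + 6 * δ ∧
      ∀ s ∈ S, ∃ σ : ℝ, (σ = 1 ∨ σ = -1) ∧
        ((R - (4 * H + 10 * δ) : ℝ) : EReal) ≤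
          Filter.liminf
            (fun tu : ℝ × ℝ => ((gp s (γ tu.1) (γloc s (σ * tu.2)) : ℝ) : EReal))
            (Filter.atTop ×ˢ Filter.atTop) ∧
        ((R - (4 * H + 10 * δ) : ℝ) : EReal) ≤
          Filter.liminf
            (fun tu : ℝ × ℝ => ((gp s (γ (-tu.1)) (γloc s (-(σ * tu.2))) : ℝ) : EReal))
            (Filter.atTop ×ˢ Filter.atTop) := by
  have hex : ∀ s, ∃ u, s ∈ S → dist s (γloc s u) < H := by
    intro s
    by_cases hs : s ∈ S
    · have := (hloc s hs).2.1 ⟨hs, mem_ball_self (by linarith)⟩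
      rw [mem_thickening_iff] at this
      obtain ⟨_, ⟨u, rfl⟩, hu⟩ := this
      exact ⟨u, fun _ => hu⟩
    · exact ⟨0, fun h => absurd h hs⟩
  choose U hU using hex
  have hl : Loc δ H R S γloc U := by
    refine ⟨hδ, hH, hR, hgeo, hslim, fun s hs => (hloc s hs).1, hU, ?_, ?_⟩
    · intro s hs t ht
      have := (hloc s hs).2.2 (show γloc s t ∈ _ from ⟨⟨t, rfl⟩, by
        rw [mem_ball]
        have h1 := dist_triangle (γloc s t) (γloc s (U s)) s
        rw [(hloc s hs).1.dist_eq, Real.dist_eq, dist_comm (γloc s (U s)) s] at h1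
        linarith [hU s hs]⟩)
      rw [mem_thickening_iff] at this
      obtain ⟨c, hc, hd⟩ := this
      exact ⟨c, hc, by rwa [dist_comm]⟩
    · intro s hs s' hs' hd
      have := (hloc s hs).2.1 ⟨hs', mem_ball.2 hd⟩
      rw [mem_thickening_iff] at this
      obtain ⟨_, ⟨u, rfl⟩, hu⟩ := this
      exact ⟨u, hu⟩
  obtain ⟨γ, hγ, hbd⟩ := hl.exists_line hSne hconn
  have hG := line_gconv hγ
  have hnear := hl.near hγ hbd
  have hex2 : ∀ s, ∃ w, s ∈ S → dist (γloc s (U s)) (γ w) ≤ 2 * δ := by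
    intro s
    by_cases hs : s ∈ S
    · obtain ⟨w, hw⟩ := hnear s hs
      exact ⟨w, fun _ => hw⟩
    · exact ⟨0, fun h => absurd h hs⟩
  choose W hW using hex2
  refine ⟨γ, hγ, ?_, ?_⟩
  · refine hausdorffDist_le_of_mem_dist (by linarith) ?_ ?_
    · rintro _ ⟨w, rfl⟩
      obtain ⟨x, hx, hd⟩ := hl.cover hγ hW hSne w
      exact ⟨x, hx, by linarith⟩
    · intro s hs
      exact ⟨γ (W s), ⟨_, rfl⟩, by
        linarith [dist_triangle s (γloc s (U s)) (γ (W s)), hU s hs, hW s hs]⟩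
  · intro s hs
    obtain ⟨σ, hσ, c, hc, d, hd, hca, hda, hWc, hWd⟩ := hl.sides hγ hW hs
    have hcf := hl.foot hW hc hca
    have hdf := hl.foot hW hd hda
    have hiso := hl.iso s hs
    refine ⟨σ, hσ, ?_, ?_⟩
    · refine le_liminf_of_le (by isBoundedDefault) ?_
      filter_upwards [(eventually_ge_atTop (W c)).prod_inl atTop,
        (eventually_ge_atTop (σ * U s + (R - H))).prod_inr atTop] with tu h1 h2
      refine EReal.coe_le_coe_iff.2 ?_
      have := gp_bound (s := s) (y := γloc s (U s)) (a := γloc s (U s + σ * (R - H)))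
        (e := γ (W s)) (a' := γ (W c)) (p := γ tu.1) (q := γloc s (σ * tu.2)) (H := H) (δ := δ)
        (R := R) (hU s hs).le ?_ (hW s hs) (by rwa [dist_comm]) ?_ ?_
      · linarith
      · rw [hiso.dist_eq, Real.dist_eq]
        rcases hσ with rfl | rfl
        · rw [abs_of_nonpos] <;> linarith
        · rw [abs_of_nonneg] <;> linarith
      · simp only [hiso.dist_eq, Real.dist_eq]
        rcases hσ with rfl | rfl
        · rw [abs_of_nonpos, abs_of_nonpos, abs_of_nonpos] <;> linarith
        · rw [abs_of_nonneg, abs_of_nonneg, abs_of_nonneg] <;> linarith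
      · simp only [hγ.dist_eq, Real.dist_eq]
        rw [abs_of_nonpos, abs_of_nonpos, abs_of_nonpos] <;> linarith
    · refine le_liminf_of_le (by isBoundedDefault) ?_
      filter_upwards [(eventually_ge_atTop (-W d)).prod_inl atTop,
        (eventually_ge_atTop (-(σ * U s) + (R - H))).prod_inr atTop] with tu h1 h2
      refine EReal.coe_le_coe_iff.2 ?_
      have := gp_bound (s := s) (y := γloc s (U s)) (a := γloc s (U s - σ * (R - H)))
        (e := γ (W s)) (a' := γ (W d)) (p := γ (-tu.1)) (q := γloc s (-(σ * tu.2))) (H := H)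
        (δ := δ) (R := R) (hU s hs).le ?_ (hW s hs) (by rwa [dist_comm]) ?_ ?_
      · linarith
      · rw [hiso.dist_eq, Real.dist_eq]
        rcases hσ with rfl | rfl
        · rw [abs_of_nonneg] <;> linarith
        · rw [abs_of_nonpos] <;> linarith
      · simp only [hiso.dist_eq, Real.dist_eq]
        rcases hσ with rfl | rfl
        · rw [abs_of_nonneg, abs_of_nonneg, abs_of_nonneg] <;> linarith
        · rw [abs_of_nonpos, abs_of_nonpos, abs_of_nonpos] <;> linarith
      · simp only [hγ.dist_eq, Real.dist_eq]
        rw [abs_of_nonneg, abs_of_nonneg, abs_of_nonneg] <;> linarith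
end
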